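/- arXiv:2212.00650 — 6 statements merged into one kernel-verified Lean document; each statement's English description precedes it below -/
import Mathlib

section
/- Let (Ω, 𝓕, μ) be a probability space, E a standard Borel space, X : Ω → E measurable, A : Ω → Bool measurable, C : Ω → ℝ measurable, and Y₀, Y₁ : Ω → ℝ integrable, with observed outcome Y(ω) = Y₁(ω) if A(ω) = true and Y₀(ω) otherwise. Fix a ∈ Bool and write Y_a for Y₁ if a = true and Y₀ otherwise. Assume: (i) NUC: A and (Y₀, Y₁) are conditionally independent given σ(X); (ii) there is a bounded measurable m_a : ℝ → ℝ with E[ Y_a | σ(C) ⊔ σ(X) ] = m_a ∘ C μ-almost everywhere. Then μ-almost everywhere: E[ 1{A = a} · Y | σ(X) ](ω) = E[ 1{A = a} | σ(X) ](ω) · ∫ m_a(c) d(condDistrib C X μ)(X ω)(c). -/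
open MeasureTheory ProbabilityTheory

/-- Conditional expectation of a product of conditionally independent variables. -/
lemma condExp_mul_of_condIndepFun_aux {Ω : Type*} {m mΩ : MeasurableSpace Ω}
    [StandardBorelSpace Ω] (hm : m ≤ mΩ)
    (μ : Measure Ω) [IsProbabilityMeasure μ] (f g : Ω → ℝ) (hf : Measurable f)
    (hfi : Integrable f μ) (hg : Integrable g μ) (hfg : Integrable (fun ω => f ω * g ω) μ)
    (h : CondIndepFun m hm f g μ) :
    μ[fun ω => f ω * g ω | m] =ᵐ[μ] fun ω => (μ[f | m]) ω * (μ[g | m]) ω := by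
  have hgk := aestronglyMeasurable_trim_condExpKernel hm hg.1
  have hg'm : Measurable (hg.1.mk g) := hg.1.stronglyMeasurable_mk.measurable
  have h' : CondIndepFun m hm f (hg.1.mk g) μ :=
    Kernel.IndepFun.congr' h (Filter.Eventually.of_forall fun _ => Filter.EventuallyEq.rfl) hgk
  have h2 := ae_of_ae_trim hm ((condIndepFun_iff_map_prod_eq_prod_map_map hf hg'm).1 h')
  filter_upwards [h2, ae_of_ae_trim hm hgk, condExp_ae_eq_integral_condExpKernel hm hfg,
    condExp_ae_eq_integral_condExpKernel hm hfi, condExp_ae_eq_integral_condExpKernel hm hg]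
    with ω h2 hgk e1 e2 e3
  rw [e1, e2, e3]
  have hind : IndepFun f (hg.1.mk g) (condExpKernel μ m ω) := by
    rw [indepFun_iff_map_prod_eq_prod_map_map hf.aemeasurable hg'm.aemeasurable]
    rw [Kernel.map_apply _ (hf.prodMk hg'm), Kernel.prod_apply, Kernel.map_apply _ hf,
      Kernel.map_apply _ hg'm] at h2
    exact h2
  rw [integral_congr_ae hgk, ← hind.integral_fun_mul_eq_mul_integral
    hf.aestronglyMeasurable hg'm.aestronglyMeasurable]
  apply integral_congr_ae
  filter_upwards [hgk] with x hx
  rw [hx]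

/-- Integral equation of the identification argument: under NUC and the existence of a
bounded measurable stratum-specific mean `m_a` with `E[Y_a | σ(C) ⊔ σ(X)] = m_a ∘ C`,
the observed-data conditional expectation `E[1{A = a}·Y | σ(X)]` equals
`E[1{A = a} | σ(X)]` times the integral of `m_a` against the regular conditional
distribution of `C` given `X`. -/
theorem integral_equation_identification
    {Ω : Type*} [MeasurableSpace Ω] [StandardBorelSpace Ω] [Nonempty Ω]
    {E : Type*} [MeasurableSpace E] [StandardBorelSpace E]
    (μ : Measure Ω) [IsProbabilityMeasure μ]
    (X : Ω → E) (hX : Measurable X)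
    (A : Ω → Bool) (hA : Measurable A)
    (C : Ω → ℝ) (hC : Measurable C)
    (Y₀ Y₁ : Ω → ℝ) (hY₀ : Integrable Y₀ μ) (hY₁ : Integrable Y₁ μ)
    (Y : Ω → ℝ) (hY : ∀ ω, Y ω = if A ω = true then Y₁ ω else Y₀ ω)
    (a : Bool)
    (hNUC : CondIndepFun (MeasurableSpace.comap X inferInstance) (hX.comap_le)
      A (fun ω => (Y₀ ω, Y₁ ω)) μ)
    (m_a : ℝ → ℝ) (hm : Measurable m_a) (hmb : ∃ M : ℝ, ∀ c, |m_a c| ≤ M)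
    (hstrat : μ[fun ω => if a = true then Y₁ ω else Y₀ ω
        | MeasurableSpace.comap C inferInstance ⊔ MeasurableSpace.comap X inferInstance]
      =ᵐ[μ] fun ω => m_a (C ω)) :
    μ[fun ω => (if A ω = a then (1 : ℝ) else 0) * Y ω
        | MeasurableSpace.comap X inferInstance]
      =ᵐ[μ]
    fun ω =>
      (μ[fun ω' => (if A ω' = a then (1 : ℝ) else 0)
          | MeasurableSpace.comap X inferInstance]) ω
      * ∫ c, m_a c ∂(condDistrib C X μ (X ω)) := by
  set Ya : Ω → ℝ := fun ω => if a = true then Y₁ ω else Y₀ ω with hYa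
  set I : Ω → ℝ := fun ω => if A ω = a then (1 : ℝ) else 0 with hI
  have hYai : Integrable Ya μ := by
    cases a
    · simpa [hYa] using hY₀
    · simpa [hYa] using hY₁
  have hφ : Measurable (fun b : Bool => if b = a then (1 : ℝ) else 0) := measurable_of_finite _
  have hIm : Measurable I := hφ.comp hA
  have hIb : ∀ᵐ ω ∂μ, ‖I ω‖ ≤ 1 := by
    refine Filter.Eventually.of_forall fun ω => ?_
    simp only [hI]
    split_ifs <;> simp
  have hIi : Integrable I μ := Integrable.of_bound hIm.aestronglyMeasurable 1 hIb
  have hprod : Integrable (fun ω => I ω * Ya ω) μ :=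
    hYai.bdd_mul hIm.aestronglyMeasurable hIb
  have hψ : Measurable (fun p : ℝ × ℝ => if a = true then p.2 else p.1) := by
    cases a
    · simpa using measurable_fst
    · simpa using measurable_snd
  have hci : CondIndepFun (MeasurableSpace.comap X inferInstance) (hX.comap_le) I Ya μ :=
    hNUC.comp hφ hψ
  have hfun : (fun ω => (if A ω = a then (1 : ℝ) else 0) * Y ω) = fun ω => I ω * Ya ω := by
    funext ω
    simp only [hI, hYa, hY]
    by_cases h : A ω = a <;> simp [h]
  have hmC : Integrable (fun ω => m_a (C ω)) μ := by
    obtain ⟨M, hM⟩ := hmb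
    exact Integrable.of_bound (hm.comp hC).aestronglyMeasurable M
      (Filter.Eventually.of_forall fun ω => hM (C ω))
  have htower := condExp_condExp_of_le (μ := μ) (f := Ya)
    (le_sup_right : MeasurableSpace.comap X inferInstance ≤
      MeasurableSpace.comap C inferInstance ⊔ MeasurableSpace.comap X inferInstance)
    (sup_le hC.comap_le hX.comap_le)
  have hcd := condExp_ae_eq_integral_condDistrib (μ := μ) hX hC.aemeasurable
    hm.stronglyMeasurable hmC
  have hcong := condExp_congr_ae (m := MeasurableSpace.comap X inferInstance) hstrat
  rw [hfun]
  filter_upwards [condExp_mul_of_condIndepFun_aux hX.comap_le μ I Ya hIm hIi hYai hprod hci,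
    htower, hcd, hcong] with ω h1 h2 h3 h4
  rw [h1, ← h2, h4, h3]
end

section
/- Let (Ω, 𝓕, μ) be a probability space, E a measurable space, X : Ω → E measurable, A : Ω → Bool measurable, Y₀, Y₁ : Ω → ℝ integrable, with observed outcome Y(ω) = Y₁(ω) if A(ω) = true and Y₀(ω) otherwise. Assume NUC: A and (Y₀, Y₁) are conditionally independent given σ(X); and positivity: for each a ∈ Bool, E[ 1{A = a} | σ(X) ] > 0 μ-almost everywhere. Let d : E → Bool be measurable (a deterministic policy), and define the potential outcome under d by Y^d(ω) = Y₁(ω) if d(X ω) = true and Y₀(ω) otherwise. Then the inverse-probability-weighted identity holds: E[ Y^d ] = E[ 1{A = d(X)} · Y / E[ 1{A = d(X)} | σ(X) ] ]. -/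
open MeasureTheory ProbabilityTheory

lemma ipw_condExp_split {Ω : Type*} {m mΩ : MeasurableSpace Ω} (hm : m ≤ mΩ)
    (μ : Measure Ω) [IsProbabilityMeasure μ] (A D : Ω → Bool) (hA : Measurable A)
    (hD : Measurable[m] D) (t : Set Ω) (ht : MeasurableSet t) :
    ∀ᵐ ω ∂μ, (μ⟦{ω | A ω = D ω} ∩ t | m⟧) ω = (μ⟦A ⁻¹' {D ω} ∩ t | m⟧) ω := by
  have hS : MeasurableSet {ω | A ω = D ω} := measurableSet_eq_fun hA (hD.mono hm le_rfl)
  have key : ∀ a : Bool, ∀ᵐ ω ∂μ, D ω = a →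
      (μ⟦{ω | A ω = D ω} ∩ t | m⟧) ω = (μ⟦A ⁻¹' {a} ∩ t | m⟧) ω := by
    intro a
    have hDa : MeasurableSet[m] (D ⁻¹' {a}) := hD (measurableSet_singleton a)
    have i1 : Integrable (({ω | A ω = D ω} ∩ t).indicator (fun _ => (1:ℝ))) μ :=
      (integrable_const _).indicator (hS.inter ht)
    have i2 : Integrable ((A ⁻¹' {a} ∩ t).indicator (fun _ => (1:ℝ))) μ :=
      (integrable_const _).indicator ((hA (measurableSet_singleton a)).inter ht)
    have h1 := condExp_indicator i1 hDa
    have h2 := condExp_indicator i2 hDa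
    have h3 : (D ⁻¹' {a}).indicator (({ω | A ω = D ω} ∩ t).indicator (fun _ => (1:ℝ)))
        = (D ⁻¹' {a}).indicator ((A ⁻¹' {a} ∩ t).indicator (fun _ => (1:ℝ))) := by
      rw [Set.indicator_indicator, Set.indicator_indicator]
      congr 1
      ext ω
      simp only [Set.mem_inter_iff, Set.mem_preimage, Set.mem_singleton_iff, Set.mem_ofPred_eq]
      constructor
      · rintro ⟨h, h', h''⟩; exact ⟨h, h'.trans h, h''⟩
      · rintro ⟨h, h', h''⟩; exact ⟨h, h'.trans h.symm, h''⟩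
    rw [h3] at h1
    filter_upwards [h1, h2] with ω e1 e2 hω
    rw [e1] at e2
    have : ω ∈ D ⁻¹' {a} := hω
    simpa [Set.indicator_of_mem this] using e2
  filter_upwards [key true, key false] with ω h1 h2
  cases h : D ω
  · exact h2 h
  · exact h1 h

lemma ipw_map_eq {Ω E F : Type*} [mΩ : MeasurableSpace Ω] [mE : MeasurableSpace E]
    [MeasurableSpace F]
    (μ : Measure Ω) [IsProbabilityMeasure μ] (X : Ω → E) (hX : Measurable X)
    (Z : Ω → F) (hZ : Measurable Z) (S : Set Ω) (hS : MeasurableSet S)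
    (h : ∀ t, MeasurableSet t → (μ⟦S ∩ Z ⁻¹' t | mE.comap X⟧) =ᵐ[μ]
      fun ω => (μ⟦S | mE.comap X⟧) ω * (μ⟦Z ⁻¹' t | mE.comap X⟧) ω) :
    (μ.restrict S).map (fun ω => (X ω, Z ω))
      = (μ.withDensity (fun ω => ENNReal.ofReal ((μ⟦S | mE.comap X⟧) ω))).map
        (fun ω => (X ω, Z ω)) := by
  have hm : mE.comap X ≤ mΩ := hX.comap_le
  have hXZ : Measurable (fun ω => (X ω, Z ω)) := hX.prodMk hZ
  apply Measure.ext_prod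
  intro b t hb ht
  have hB : MeasurableSet[mE.comap X] (X ⁻¹' b) := ⟨b, hb, rfl⟩
  have hT : MeasurableSet (Z ⁻¹' t) := hZ ht
  rw [Measure.map_apply hXZ (hb.prod ht), Measure.map_apply hXZ (hb.prod ht)]
  have hpre : (fun ω => (X ω, Z ω)) ⁻¹' (b ×ˢ t) = X ⁻¹' b ∩ Z ⁻¹' t := rfl
  rw [hpre, Measure.restrict_apply ((hm _ hB).inter hT),
    withDensity_apply _ ((hm _ hB).inter hT)]
  have hp0 : 0 ≤ᵐ[μ] μ⟦S | mE.comap X⟧ :=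
    condExp_nonneg (ae_of_all _ fun ω => Set.indicator_nonneg (fun _ _ => zero_le_one) _)
  rw [← ofReal_integral_eq_lintegral_ofReal integrable_condExp.integrableOn
    (ae_restrict_of_ae hp0)]
  have iT : Integrable ((Z ⁻¹' t).indicator (fun _ => (1:ℝ))) μ :=
    (integrable_const _).indicator hT
  have iST : Integrable ((S ∩ Z ⁻¹' t).indicator (fun _ => (1:ℝ))) μ :=
    (integrable_const _).indicator (hS.inter hT)
  have hmul : (μ⟦S | mE.comap X⟧) * (Z ⁻¹' t).indicator (fun _ => (1:ℝ))
      = (Z ⁻¹' t).indicator (μ⟦S | mE.comap X⟧) := by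
    ext ω; by_cases hω : ω ∈ Z ⁻¹' t <;> simp [hω]
  have iPT : Integrable ((μ⟦S | mE.comap X⟧) * (Z ⁻¹' t).indicator (fun _ => (1:ℝ))) μ := by
    rw [hmul]; exact integrable_condExp.indicator hT
  have pull := condExp_mul_of_stronglyMeasurable_left
    (stronglyMeasurable_condExp (m := mE.comap X) (μ := μ)
      (f := S.indicator (fun _ => (1:ℝ)))) iPT iT
  have e : ∫ ω in X ⁻¹' b ∩ Z ⁻¹' t, (μ⟦S | mE.comap X⟧) ω ∂μ
      = μ.real ((X ⁻¹' b ∩ Z ⁻¹' t) ∩ S) := by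
    calc ∫ ω in X ⁻¹' b ∩ Z ⁻¹' t, (μ⟦S | mE.comap X⟧) ω ∂μ
        = ∫ ω in X ⁻¹' b,
          ((μ⟦S | mE.comap X⟧) * (Z ⁻¹' t).indicator (fun _ => (1:ℝ))) ω ∂μ := by
          rw [hmul, setIntegral_indicator hT]
      _ = ∫ ω in X ⁻¹' b, (μ⟦S ∩ Z ⁻¹' t | mE.comap X⟧) ω ∂μ := by
          rw [← setIntegral_condExp hm iPT hB]
          apply integral_congr_ae
          apply ae_restrict_of_ae
          filter_upwards [pull, h t ht] with ω h1 h2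
          rw [h1, h2]; rfl
      _ = ∫ ω in X ⁻¹' b, (S ∩ Z ⁻¹' t).indicator (fun _ => (1:ℝ)) ω ∂μ :=
          setIntegral_condExp hm iST hB
      _ = μ.real ((X ⁻¹' b ∩ Z ⁻¹' t) ∩ S) := by
          rw [setIntegral_indicator (hS.inter hT)]
          simp only [integral_const, smul_eq_mul, mul_one, measureReal_restrict_apply_univ]
          congr 1
          ext ω; simp only [Set.mem_inter_iff]; tauto
  rw [e, ofReal_measureReal]

/-- Inverse-probability-weighting identity: under NUC and positivity, the value of a
deterministic policy `d`, i.e. the mean of the potential outcome `Y^d`, equals the mean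
of the IPW-transformed observed outcome. -/
theorem ipw_identity
    {Ω : Type*} [MeasurableSpace Ω] [StandardBorelSpace Ω] [Nonempty Ω]
    {E : Type*} [MeasurableSpace E]
    (μ : Measure Ω) [IsProbabilityMeasure μ]
    (X : Ω → E) (hX : Measurable X)
    (A : Ω → Bool) (hA : Measurable A)
    (Y₀ Y₁ : Ω → ℝ) (hY₀ : Integrable Y₀ μ) (hY₁ : Integrable Y₁ μ)
    (Y : Ω → ℝ) (hY : ∀ ω, Y ω = if A ω = true then Y₁ ω else Y₀ ω)
    (hNUC : CondIndepFun (MeasurableSpace.comap X inferInstance) (hX.comap_le)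
      A (fun ω => (Y₀ ω, Y₁ ω)) μ)
    (hpos : ∀ a : Bool, ∀ᵐ ω ∂μ,
      0 < (μ[fun ω' => (if A ω' = a then (1 : ℝ) else 0)
        | MeasurableSpace.comap X inferInstance]) ω)
    (d : E → Bool) (hd : Measurable d)
    (Yd : Ω → ℝ) (hYd : ∀ ω, Yd ω = if d (X ω) = true then Y₁ ω else Y₀ ω) :
    ∫ ω, Yd ω ∂μ
      = ∫ ω, (if A ω = d (X ω) then (1 : ℝ) else 0) * Y ω
          / (μ[fun ω' => (if A ω' = d (X ω') then (1 : ℝ) else 0)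
              | MeasurableSpace.comap X inferInstance]) ω ∂μ := by
  rename_i mΩ _ _ mE _
  have hm : mE.comap X ≤ mΩ := hX.comap_le
  -- measurable versions of the potential outcomes
  obtain ⟨W₀, hW₀, e₀⟩ := hY₀.1.aemeasurable
  obtain ⟨W₁, hW₁, e₁⟩ := hY₁.1.aemeasurable
  set Z : Ω → ℝ × ℝ := fun ω => (W₀ ω, W₁ ω) with hZdef
  have hZ : Measurable Z := hW₀.prodMk hW₁
  have hind : CondIndepFun (mE.comap X) hm A Z μ := by
    refine Kernel.IndepFun.congr' hNUC (ae_of_all _ fun _ => Filter.EventuallyEq.rfl) ?_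
    have hz : (fun ω => (Y₀ ω, Y₁ ω)) =ᵐ[μ] Z := by
      filter_upwards [e₀, e₁] with ω h0 h1
      simp [hZdef, h0, h1]
    rw [← condExpKernel_comp_trim (μ := μ) hm] at hz
    exact Measure.ae_ae_of_ae_comp hz
  rw [condIndepFun_iff_condExp_inter_preimage_eq_mul hA hZ] at hind
  have hD : Measurable[mE.comap X] (fun ω => d (X ω)) := hd.comp (comap_measurable X)
  set S : Set Ω := {ω | A ω = d (X ω)} with hSdef
  have hS : MeasurableSet S := measurableSet_eq_fun hA (hd.comp hX)
  have hfun : (fun ω' => (if A ω' = d (X ω') then (1 : ℝ) else 0))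
      = S.indicator (fun _ => (1:ℝ)) := by
    ext ω; simp [Set.indicator, hSdef]
  have hfunA : ∀ a, (fun ω' => (if A ω' = a then (1 : ℝ) else 0))
      = (A ⁻¹' {a}).indicator (fun _ => (1:ℝ)) := by
    intro a; ext ω; simp [Set.indicator]
  simp only [hfunA] at hpos
  rw [hfun]
  have hp : ∀ᵐ ω ∂μ, (μ⟦S | mE.comap X⟧) ω = (μ⟦A ⁻¹' {d (X ω)} | mE.comap X⟧) ω := by
    simpa only [Set.inter_univ] using
      ipw_condExp_split hm μ A (fun ω => d (X ω)) hA hD Set.univ MeasurableSet.univ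
  have hppos : ∀ᵐ ω ∂μ, 0 < (μ⟦S | mE.comap X⟧) ω := by
    filter_upwards [hp, hpos true, hpos false] with ω h1 ht hf
    rw [h1]
    cases d (X ω)
    · exact hf
    · exact ht
  have hmap := ipw_map_eq μ X hX Z hZ S hS (by
    intro t ht
    filter_upwards [hp, ipw_condExp_split hm μ A (fun ω => d (X ω)) hA hD _ (hZ ht),
      hind {true} t (measurableSet_singleton _) ht,
      hind {false} t (measurableSet_singleton _) ht] with ω h1 h2 h3 h4
    rw [h1, h2]
    cases d (X ω)
    · exact h4
    · exact h3)
  have hpm : StronglyMeasurable[mE.comap X] (μ⟦S | mE.comap X⟧) := stronglyMeasurable_condExp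
  obtain ⟨g, hg, hpg⟩ := hpm.measurable.exists_eq_measurable_comp
  set p := μ⟦S | mE.comap X⟧ with hpdef
  have hpX : ∀ ω, p ω = g (X ω) := fun ω => congrFun hpg ω
  let f : E × ℝ × ℝ → ℝ := fun q => (if d q.1 = true then q.2.2 else q.2.1) / g q.1
  have hf : Measurable f := by
    refine Measurable.div (Measurable.ite ?_ (by fun_prop) (by fun_prop)) (by fun_prop)
    exact (hd.comp measurable_fst) (measurableSet_singleton true)
  have hXZ : Measurable (fun ω => (X ω, Z ω)) := hX.prodMk hZ
  have hpmeas : Measurable p := hpm.measurable.mono hm le_rfl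
  have hI := congrArg (fun ν => ∫ q, f q ∂ν) hmap
  rw [integral_map hXZ.aemeasurable hf.aestronglyMeasurable,
    integral_map hXZ.aemeasurable hf.aestronglyMeasurable,
    integral_withDensity_eq_integral_toReal_smul hpmeas.ennreal_ofReal
      (ae_of_all _ fun _ => ENNReal.ofReal_lt_top), ← integral_indicator hS] at hI
  calc ∫ ω, Yd ω ∂μ
      = ∫ ω, (ENNReal.ofReal (p ω)).toReal • f (X ω, Z ω) ∂μ := by
        apply integral_congr_ae
        filter_upwards [e₀, e₁, hppos] with ω h0 h1 h2
        rw [ENNReal.toReal_ofReal h2.le, hYd, h0, h1, smul_eq_mul]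
        simp only [f, hZdef, ← hpX]
        field_simp
    _ = ∫ ω, S.indicator (fun ω => f (X ω, Z ω)) ω ∂μ := hI.symm
    _ = _ := by
        apply integral_congr_ae
        filter_upwards [e₀, e₁] with ω h0 h1
        by_cases hω : A ω = d (X ω)
        · have : ω ∈ S := hω
          rw [Set.indicator_of_mem this, if_pos hω, hY, h0, h1, hω, one_mul, hpX]
        · have : ω ∉ S := hω
          rw [Set.indicator_of_notMem this, if_neg hω]
          simp
end

section
/- Let (Ω, 𝓕, μ) be a probability space, E a measurable space, X : Ω → E measurable, A : Ω → Bool measurable, Y₀, Y₁ : Ω → ℝ integrable, with observed outcome Y(ω) = Y₁(ω) if A(ω) = true and Y₀(ω) otherwise. Assume NUC: A and (Y₀, Y₁) are conditionally independent given σ(X); and positivity: for each a ∈ Bool, E[ 1{A = a} | σ(X) ] > 0 μ-almost everywhere. Let d : E → Bool be measurable and Y^d(ω) = Y₁(ω) if d(X ω) = true and Y₀(ω) otherwise. Then the G-computation identity holds: E[ Y^d ] = ∫ ( 1{d(X ω) = true} · (E[1{A = true} Y | σ(X)](ω) / E[1{A = true} | σ(X)](ω)) + 1{d(X ω) = false}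 · (E[1{A = false} Y | σ(X)](ω) / E[1{A = false} | σ(X)](ω)) ) dμ(ω). -/
open MeasureTheory ProbabilityTheory

theorem aux_condExp_mul {Ω : Type*} {m mΩ : MeasurableSpace Ω} [StandardBorelSpace Ω] [Nonempty Ω]
    (hm : m ≤ mΩ) (μ : Measure Ω) [IsProbabilityMeasure μ]
    (U Z : Ω → ℝ) (hU : Measurable U) (hUi : Integrable U μ) (hZ : Integrable Z μ)
    (hUZ : Integrable (fun ω => U ω * Z ω) μ)
    (h : CondIndepFun m hm U Z μ) :
    μ[fun ω => U ω * Z ω | m] =ᵐ[μ] fun ω => (μ[U | m]) ω * (μ[Z | m]) ω := by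
  have hZm : AEMeasurable Z μ := hZ.1.aemeasurable
  have hae : ∀ᵐ a ∂(μ.trim hm), Z =ᵐ[condExpKernel μ m a] hZm.mk Z := by
    refine Measure.ae_ae_of_ae_comp ?_
    rw [condExpKernel_comp_trim]
    exact hZm.ae_eq_mk
  have h' : CondIndepFun m hm U (hZm.mk Z) μ :=
    Kernel.IndepFun.congr' h (Filter.Eventually.of_forall fun _ => Filter.EventuallyEq.rfl) hae
  rw [condIndepFun_iff_map_prod_eq_prod_map_map hU hZm.measurable_mk] at h'
  filter_upwards [condExp_ae_eq_integral_condExpKernel hm hUZ,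
    condExp_ae_eq_integral_condExpKernel hm hUi, condExp_ae_eq_integral_condExpKernel hm hZ,
    ae_of_ae_trim hm hae, ae_of_ae_trim hm h'] with ω h1 h2 h3 h4 h5
  rw [h1, h2, h3]
  have hU' : Measurable[mΩ] U := hU
  have hind : IndepFun U (hZm.mk Z) (condExpKernel μ m ω) := by
    rw [indepFun_iff_map_prod_eq_prod_map_map hU.aemeasurable hZm.measurable_mk.aemeasurable]
    rw [Kernel.map_apply _ (hU.prodMk hZm.measurable_mk), Kernel.prod_apply,
      Kernel.map_apply _ hU, Kernel.map_apply _ hZm.measurable_mk] at h5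
    exact h5
  have e1 : ∫ y, Z y ∂(condExpKernel μ m ω) = ∫ y, hZm.mk Z y ∂(condExpKernel μ m ω) :=
    integral_congr_ae h4
  have e2 : ∫ y, U y * Z y ∂(condExpKernel μ m ω)
      = ∫ y, U y * hZm.mk Z y ∂(condExpKernel μ m ω) :=
    integral_congr_ae (by filter_upwards [h4] with y hy; rw [hy])
  rw [e1, e2]
  exact hind.integral_fun_mul_eq_mul_integral hU.aestronglyMeasurable
    hZm.measurable_mk.aestronglyMeasurable

theorem aux_ratio {Ω : Type*} {m mΩ : MeasurableSpace Ω} [StandardBorelSpace Ω] [Nonempty Ω]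
    (hm : m ≤ mΩ) (μ : Measure Ω) [IsProbabilityMeasure μ]
    (A : Ω → Bool) (hA : Measurable A) (a : Bool)
    (Y Z : Ω → ℝ) (hZ : Integrable Z μ) (hYZ : ∀ ω, A ω = a → Y ω = Z ω)
    (h : CondIndepFun m hm A Z μ)
    (hpos : ∀ᵐ ω ∂μ, 0 < (μ[fun ω' => (if A ω' = a then (1 : ℝ) else 0) | m]) ω) :
    (fun ω => (μ[fun ω' => (if A ω' = a then (1 : ℝ) else 0) * Y ω' | m]) ω
      / (μ[fun ω' => (if A ω' = a then (1 : ℝ) else 0) | m]) ω) =ᵐ[μ] μ[Z | m] := by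
  have hφ : Measurable (fun b : Bool => if b = a then (1 : ℝ) else 0) := measurable_of_finite _
  have hU : Measurable (fun ω' => (if A ω' = a then (1 : ℝ) else 0)) := hφ.comp hA
  have hb : ∀ ω, ‖(if A ω = a then (1 : ℝ) else 0)‖ ≤ 1 := by
    intro ω; split_ifs <;> simp
  have hUi : Integrable (fun ω' => (if A ω' = a then (1 : ℝ) else 0)) μ :=
    Integrable.of_bound hU.aestronglyMeasurable 1 (Filter.Eventually.of_forall hb)
  have hUZ : Integrable (fun ω' => (if A ω' = a then (1 : ℝ) else 0) * Z ω') μ :=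
    hZ.bdd_mul hU.aestronglyMeasurable (Filter.Eventually.of_forall hb)
  have e : (fun ω' => (if A ω' = a then (1 : ℝ) else 0) * Y ω')
      = fun ω' => (if A ω' = a then (1 : ℝ) else 0) * Z ω' := by
    funext ω
    by_cases hc : A ω = a
    · rw [hYZ ω hc]
    · simp [hc]
  rw [e]
  have hind : CondIndepFun m hm (fun ω' => (if A ω' = a then (1 : ℝ) else 0)) Z μ :=
    h.comp hφ measurable_id
  filter_upwards [aux_condExp_mul hm μ _ Z hU hUi hZ hUZ hind, hpos] with ω h1 h2
  rw [h1]
  field_simp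

theorem aux_pull {Ω : Type*} {m mΩ : MeasurableSpace Ω}
    (hm : m ≤ mΩ) (μ : Measure Ω) [IsProbabilityMeasure μ]
    (D : Ω → Bool) (hD : Measurable[m] D) (a : Bool) (Z : Ω → ℝ) (hZ : Integrable Z μ) :
    Integrable (fun ω => (if D ω = a then (1 : ℝ) else 0) * Z ω) μ ∧
    μ[fun ω => (if D ω = a then (1 : ℝ) else 0) * Z ω | m]
      =ᵐ[μ] fun ω => (if D ω = a then (1 : ℝ) else 0) * (μ[Z | m]) ω := by
  have hφ : Measurable (fun b : Bool => if b = a then (1 : ℝ) else 0) := measurable_of_finite _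
  have hU : Measurable[m] (fun ω' => (if D ω' = a then (1 : ℝ) else 0)) := hφ.comp hD
  have hb : ∀ ω, ‖(if D ω = a then (1 : ℝ) else 0)‖ ≤ 1 := by
    intro ω; split_ifs <;> simp
  have hUZ : Integrable (fun ω' => (if D ω' = a then (1 : ℝ) else 0) * Z ω') μ :=
    hZ.bdd_mul (hU.mono hm le_rfl).aestronglyMeasurable (Filter.Eventually.of_forall hb)
  exact ⟨hUZ, condExp_mul_of_stronglyMeasurable_left hU.stronglyMeasurable hUZ hZ⟩

/-- G-computation identity: under NUC and positivity, the value of a deterministic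
policy `d` equals the mean of the policy-selected ratio of observed-data conditional
expectations `E[1{A = a}·Y | σ(X)] / E[1{A = a} | σ(X)]`. -/
theorem g_computation_identity
    {Ω : Type*} [MeasurableSpace Ω] [StandardBorelSpace Ω] [Nonempty Ω]
    {E : Type*} [MeasurableSpace E]
    (μ : Measure Ω) [IsProbabilityMeasure μ]
    (X : Ω → E) (hX : Measurable X)
    (A : Ω → Bool) (hA : Measurable A)
    (Y₀ Y₁ : Ω → ℝ) (hY₀ : Integrable Y₀ μ) (hY₁ : Integrable Y₁ μ)
    (Y : Ω → ℝ) (hY : ∀ ω, Y ω = if A ω = true then Y₁ ω else Y₀ ω)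
    (hNUC : CondIndepFun (MeasurableSpace.comap X inferInstance) (hX.comap_le)
      A (fun ω => (Y₀ ω, Y₁ ω)) μ)
    (hpos : ∀ a : Bool, ∀ᵐ ω ∂μ,
      0 < (μ[fun ω' => (if A ω' = a then (1 : ℝ) else 0)
        | MeasurableSpace.comap X inferInstance]) ω)
    (d : E → Bool) (hd : Measurable d)
    (Yd : Ω → ℝ) (hYd : ∀ ω, Yd ω = if d (X ω) = true then Y₁ ω else Y₀ ω) :
    ∫ ω, Yd ω ∂μ
      = ∫ ω,
          (if d (X ω) = true then (1 : ℝ) else 0)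
            * ((μ[fun ω' => (if A ω' = true then (1 : ℝ) else 0) * Y ω'
                  | MeasurableSpace.comap X inferInstance]) ω
              / (μ[fun ω' => (if A ω' = true then (1 : ℝ) else 0)
                  | MeasurableSpace.comap X inferInstance]) ω)
          + (if d (X ω) = false then (1 : ℝ) else 0)
            * ((μ[fun ω' => (if A ω' = false then (1 : ℝ) else 0) * Y ω'
                  | MeasurableSpace.comap X inferInstance]) ω
              / (μ[fun ω' => (if A ω' = false then (1 : ℝ) else 0)
                  | MeasurableSpace.comap X inferInstance]) ω) ∂μ := by
  have hm := hX.comap_le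
  have hD : Measurable[MeasurableSpace.comap X inferInstance] (fun ω => d (X ω)) :=
    hd.comp (comap_measurable X)
  have r1 := aux_ratio hm μ A hA true Y Y₁ hY₁ (fun ω h => by rw [hY, if_pos h])
    (hNUC.comp measurable_id measurable_snd) (hpos true)
  have r0 := aux_ratio hm μ A hA false Y Y₀ hY₀ (fun ω h => by rw [hY]; simp [h])
    (hNUC.comp measurable_id measurable_fst) (hpos false)
  obtain ⟨i1, p1⟩ := aux_pull hm μ _ hD true Y₁ hY₁
  obtain ⟨i0, p0⟩ := aux_pull hm μ _ hD false Y₀ hY₀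
  have e : Yd = fun ω => (if d (X ω) = true then (1 : ℝ) else 0) * Y₁ ω
      + (if d (X ω) = false then (1 : ℝ) else 0) * Y₀ ω := by
    funext ω
    rw [hYd]
    cases d (X ω) <;> simp
  rw [e, integral_add i1 i0, ← integral_condExp hm (f := fun ω => _ * Y₁ ω),
    ← integral_condExp hm (f := fun ω => _ * Y₀ ω),
    ← integral_add integrable_condExp integrable_condExp]
  refine integral_congr_ae ?_
  filter_upwards [r1, r0, p1, p0] with ω h1 h0 q1 q0
  rw [q1, q0, h1, h0]
end

section
/- Let t, m ∈ ℝ and σ > 0, and let γ = gaussianReal m σ² be the Gaussian measure on ℝ with mean m and variance σ². Then ∫ max (t − z) 0 dγ(z) ≥ max (t − m) 0, and moreover ∫ max (t − z) 0 dγ(z) > 0. -/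
open MeasureTheory ProbabilityTheory Real

/-- The result for an arbitrary nonzero variance. -/
theorem expected_improvement_aux (t m : ℝ) (v : NNReal) (hv : v ≠ 0) :
    max (t - m) 0 ≤ ∫ z, max (t - z) 0 ∂(gaussianReal m v)
      ∧ 0 < ∫ z, max (t - z) 0 ∂(gaussianReal m v) := by
  have hid : Integrable (fun z : ℝ => z) (gaussianReal m v) :=
    (memLp_id_gaussianReal (μ := m) (v := v) 1).integrable (by simp)
  have hsub : Integrable (fun z : ℝ => t - z) (gaussianReal m v) :=
    (integrable_const t).sub hid
  have hmax : Integrable (fun z : ℝ => max (t - z) 0) (gaussianReal m v) := hsub.pos_part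
  have hnn : ∀ z : ℝ, 0 ≤ max (t - z) 0 := fun z => le_max_right _ _
  refine ⟨max_le ?_ (integral_nonneg hnn), ?_⟩
  · have h1 : ∫ z, (t - z) ∂(gaussianReal m v) = t - m := by
      rw [integral_sub (integrable_const t) hid, integral_id_gaussianReal]
      simp
    rw [← h1]
    exact integral_mono hsub hmax (fun z => le_max_left _ _)
  · rw [integral_pos_iff_support_of_nonneg hnn hmax, pos_iff_ne_zero]
    intro h0
    have h1 := gaussianReal_absolutelyContinuous' m hv h0
    have h2 : volume (Set.Iio t) = 0 := by
      refine measure_mono_null ?_ h1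
      intro z hz
      have hz' : z < t := hz
      have : 0 < max (t - z) 0 := lt_max_of_lt_left (by linarith)
      exact this.ne'
    simp at h2

/-- Exploration–exploitation property of Expected Improvement: for a Gaussian measure
with mean `m` and variance `σ² > 0`, the expected improvement `∫ max (t − z) 0 dγ(z)`
dominates the plug-in improvement `max (t − m) 0` and is strictly positive. -/
theorem expected_improvement_pos (t m σ : ℝ) (hσ : 0 < σ) :
    max (t - m) 0 ≤ ∫ z, max (t - z) 0 ∂(gaussianReal m ⟨σ ^ 2, sq_nonneg σ⟩)
      ∧ 0 < ∫ z, max (t - z) 0 ∂(gaussianReal m ⟨σ ^ 2, sq_nonneg σ⟩) := by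
  have hv : (⟨σ ^ 2, sq_nonneg σ⟩ : NNReal) ≠ 0 := by
    intro h
    have h2 : σ ^ 2 = 0 := congrArg NNReal.toReal h
    have : 0 < σ ^ 2 := by positivity
    linarith
  exact expected_improvement_aux t m _ hv
end

section
/- Let μ be a probability measure on ℝ × ℝ, and let s₁₁ > 0, s₁₂, s₂₂ ∈ ℝ be such that for every a, b ∈ ℝ the pushforward of μ under (x, y) ↦ a·x + b·y equals the Gaussian measure gaussianReal 0 (a²s₁₁ + 2ab·s₁₂ + b²s₂₂) on ℝ (i.e., μ is a centered bivariate Gaussian with covariance matrix [[s₁₁, s₁₂], [s₁₂, s₂₂]]). Then the conditional expectation of the second coordinate given the σ-algebra generated by the first coordinate satisfies, μ-almost everywhere: E[(x, y) ↦ y | σ(Prod.fst)] (x, y) = (s₁₂ / s₁₁) · x. -/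
open MeasureTheory ProbabilityTheory

/-- Bivariate Gaussian conditioning formula (posterior predictive mean of a Gaussian
process, n = 1 case): if `μ` is a centered bivariate Gaussian on `ℝ × ℝ` with
covariance matrix `[[s₁₁, s₁₂], [s₁₂, s₂₂]]` (characterized by the distribution of
linear combinations) and `s₁₁ > 0`, then the conditional expectation of the second
coordinate given the first is `(s₁₂ / s₁₁) · x` almost everywhere. -/
theorem bivariate_gaussian_condexp
    (μ : Measure (ℝ × ℝ)) [IsProbabilityMeasure μ]
    (s₁₁ s₁₂ s₂₂ : ℝ) (hs₁₁ : 0 < s₁₁)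
    (hgauss : ∀ a b : ℝ,
      μ.map (fun p : ℝ × ℝ => a * p.1 + b * p.2)
        = gaussianReal 0 (Real.toNNReal (a ^ 2 * s₁₁ + 2 * a * b * s₁₂ + b ^ 2 * s₂₂))) :
    μ[fun p : ℝ × ℝ => p.2
      | MeasurableSpace.comap (Prod.fst : ℝ × ℝ → ℝ) inferInstance]
      =ᵐ[μ] fun p : ℝ × ℝ => (s₁₂ / s₁₁) * p.1 := by
  have hmeas : ∀ a b : ℝ, Measurable (fun p : ℝ × ℝ => a * p.1 + b * p.2) := by
    intro a b
    fun_prop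
  have hmean : ∀ a b : ℝ, ∫ p : ℝ × ℝ, (a * p.1 + b * p.2) ∂μ = 0 := by
    intro a b
    have h := integral_map (μ := μ) (hmeas a b).aemeasurable
      (f := fun x : ℝ => x) (by fun_prop)
    rw [hgauss, integral_id_gaussianReal] at h
    exact h.symm
  have hvar : ∀ a b : ℝ, Var[fun p : ℝ × ℝ => a * p.1 + b * p.2; μ]
      = (Real.toNNReal (a ^ 2 * s₁₁ + 2 * a * b * s₁₂ + b ^ 2 * s₂₂) : ℝ) := by
    intro a b
    rw [← variance_id_map (hmeas a b).aemeasurable, hgauss, variance_id_gaussianReal]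
  have hG : IsGaussian μ := by
    refine ⟨fun L => ?_⟩
    have hL : (L : ℝ × ℝ → ℝ) = fun p : ℝ × ℝ => L (1, 0) * p.1 + L (0, 1) * p.2 := by
      funext p
      have hp : p = p.1 • ((1 : ℝ), (0 : ℝ)) + p.2 • ((0 : ℝ), (1 : ℝ)) := by
        ext <;> simp
      conv_lhs => rw [hp]
      rw [map_add, map_smul, map_smul]
      simp only [smul_eq_mul]
      ring
    rw [hL, hgauss, hmean, hvar, Real.toNNReal_coe]
  set c : ℝ := s₁₂ / s₁₁ with hc
  have hcs : c * s₁₁ = s₁₂ := by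
    rw [hc]
    field_simp
  let X : ℝ × ℝ → ℝ := fun p => p.1
  let Z : ℝ × ℝ → ℝ := fun p => p.2 - c * p.1
  have hXZ : HasGaussianLaw (fun p => (X p, Z p)) μ :=
    (IsGaussian.hasGaussianLaw_id (μ := μ)).map_fun
      ((ContinuousLinearMap.fst ℝ ℝ ℝ).prod
        (ContinuousLinearMap.snd ℝ ℝ ℝ - c • ContinuousLinearMap.fst ℝ ℝ ℝ))
  have hX2 : MemLp X 2 μ := hXZ.fst.memLp_two
  have hZ2 : MemLp Z 2 μ := hXZ.snd.memLp_two
  have hcov : cov[X, Z; μ] = 0 := by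
    have h1 := variance_add hX2 hZ2
    have h2 := variance_sub hX2 hZ2
    have e1 : X + Z = fun p : ℝ × ℝ => (1 - c) * p.1 + 1 * p.2 := by
      funext p
      simp only [X, Z, Pi.add_apply]
      ring
    have e2 : X - Z = fun p : ℝ × ℝ => (1 + c) * p.1 + (-1) * p.2 := by
      funext p
      simp only [X, Z, Pi.sub_apply]
      ring
    have e3 : (1 - c) ^ 2 * s₁₁ + 2 * (1 - c) * 1 * s₁₂ + 1 ^ 2 * s₂₂
        = (1 + c) ^ 2 * s₁₁ + 2 * (1 + c) * (-1) * s₁₂ + (-1) ^ 2 * s₂₂ := by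
      rw [← hcs]
      ring
    rw [e1, hvar, e3] at h1
    rw [e2, hvar] at h2
    linarith
  have hind : IndepFun X Z μ := hXZ.indepFun_of_covariance_eq_zero hcov
  have hXm : Measurable X := by fun_prop
  have hZm : Measurable Z := by fun_prop
  have hZint : ∫ p, Z p ∂μ = 0 := by
    rw [← hmean (-c) 1]
    congr 1
    funext p
    simp only [Z]
    ring
  have hle : MeasurableSpace.comap (Prod.fst : ℝ × ℝ → ℝ) inferInstance
      ≤ (inferInstance : MeasurableSpace (ℝ × ℝ)) := hXm.comap_le
  have hcZ : μ[Z | MeasurableSpace.comap (Prod.fst : ℝ × ℝ → ℝ) inferInstance]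
      =ᵐ[μ] fun _ => ∫ p, Z p ∂μ :=
    condExp_indep_eq hZm.comap_le hle
      (comap_measurable Z).stronglyMeasurable hind.symm
  have hcX : μ[fun p : ℝ × ℝ => c * p.1
      | MeasurableSpace.comap (Prod.fst : ℝ × ℝ → ℝ) inferInstance]
      = fun p : ℝ × ℝ => c * p.1 := by
    refine condExp_of_stronglyMeasurable hle ?_ ?_
    · exact ((comap_measurable (Prod.fst : ℝ × ℝ → ℝ)).const_mul c).stronglyMeasurable
    · exact hXZ.fst.integrable.const_mul c
  have hsum : (fun p : ℝ × ℝ => p.2) = Z + fun p : ℝ × ℝ => c * p.1 := by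
    funext p
    simp [Z]
  rw [hsum]
  have hadd := condExp_add (μ := μ) hXZ.snd.integrable (hXZ.fst.integrable.const_mul c)
    (MeasurableSpace.comap (Prod.fst : ℝ × ℝ → ℝ) inferInstance)
  refine hadd.trans ?_
  filter_upwards [hcZ] with p hp
  rw [Pi.add_apply, hp, hZint, zero_add]
  exact congrFun hcX p
end

section
/- Let γ₀, γ₁ ∈ ℝ and define V(β₁, β₂) = γ₀ + γ₁/2 + (Real.sin (4π·β₁) − Real.sin (4π·β₂)) / (4π) for 0 ≤ β₁ ≤ β₂ ≤ 1. Then for all such (β₁, β₂), V(β₁, β₂) ≤ γ₀ + γ₁/2 + 1/(2π), and equality holds if and only if (β₁, β₂) ∈ {(1/8, 3/8), (1/8, 7/8), (5/8, 7/8)}. -/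
open Real

lemma aux_sin_one (x : ℝ) (h0 : 0 ≤ x) (h1 : x ≤ 1) :
    Real.sin (4 * π * x) = 1 ↔ x = 1/8 ∨ x = 5/8 := by
  rw [Real.sin_eq_one_iff]
  constructor
  · rintro ⟨k, hk⟩
    have hx : x = 1/8 + k / 2 := by
      have : π * (4 * x) = π * (1/2 + 2 * k) := by linarith
      have := mul_left_cancel₀ Real.pi_ne_zero this
      linarith
    have a : (-1 : ℝ) < k := by linarith
    have b : (k : ℝ) < 2 := by linarith
    have a' : -1 < k := by exact_mod_cast a
    have b' : k < 2 := by exact_mod_cast b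
    have : k = 0 ∨ k = 1 := by omega
    rcases this with rfl | rfl
    · left; rw [hx]; norm_num
    · right; rw [hx]; norm_num
  · rintro (rfl | rfl)
    · exact ⟨0, by push_cast; ring⟩
    · exact ⟨1, by push_cast; ring⟩

lemma aux_sin_neg_one (x : ℝ) (h0 : 0 ≤ x) (h1 : x ≤ 1) :
    Real.sin (4 * π * x) = -1 ↔ x = 3/8 ∨ x = 7/8 := by
  have h := aux_sin_one (1 - x) (by linarith) (by linarith)
  have e : Real.sin (4 * π * (1 - x)) = - Real.sin (4 * π * x) := by
    have : 4 * π * (1 - x) = -(4 * π * x) + (2 : ℕ) * (2 * π) := by push_cast; ring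
    rw [this, Real.sin_add_nat_mul_two_pi, Real.sin_neg]
  rw [e] at h
  constructor
  · intro hs
    rcases h.1 (by linarith) with h | h
    · right; linarith
    · left; linarith
  · rintro (hx | hx)
    · linarith [h.2 (Or.inr (by linarith))]
    · linarith [h.2 (Or.inl (by linarith))]

/-- Multiple optimal policies in Simulation Setting 3 with `w = 1`: the value
`V(β₁, β₂) = γ₀ + γ₁/2 + (sin(4πβ₁) − sin(4πβ₂))/(4π)` over `0 ≤ β₁ ≤ β₂ ≤ 1` is at
most `γ₀ + γ₁/2 + 1/(2π)`, with equality iff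
`(β₁, β₂) ∈ {(1/8, 3/8), (1/8, 7/8), (5/8, 7/8)}`. -/
theorem sim_setting3_optimal_policies (γ₀ γ₁ : ℝ) :
    ∀ β₁ β₂ : ℝ, 0 ≤ β₁ → β₁ ≤ β₂ → β₂ ≤ 1 →
      (γ₀ + γ₁ / 2 + (Real.sin (4 * π * β₁) - Real.sin (4 * π * β₂)) / (4 * π)
          ≤ γ₀ + γ₁ / 2 + 1 / (2 * π))
      ∧ (γ₀ + γ₁ / 2 + (Real.sin (4 * π * β₁) - Real.sin (4 * π * β₂)) / (4 * π)
            = γ₀ + γ₁ / 2 + 1 / (2 * π)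
          ↔ ((β₁, β₂) : ℝ × ℝ) ∈
              ({(1/8, 3/8), (1/8, 7/8), (5/8, 7/8)} : Set (ℝ × ℝ))) := by
  intro b c h0 hbc h1
  have hpi := Real.pi_pos
  have e : (1 : ℝ) / (2 * π) = 2 / (4 * π) := by field_simp; norm_num
  have u := Real.sin_le_one (4 * π * b)
  have v := Real.neg_one_le_sin (4 * π * c)
  have hb := aux_sin_one b h0 (by linarith)
  have hc := aux_sin_neg_one c (by linarith) h1
  rw [e]
  refine ⟨?_, ?_⟩
  · have : (Real.sin (4 * π * b) - Real.sin (4 * π * c)) / (4 * π) ≤ 2 / (4 * π) := by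
      apply div_le_div_of_nonneg_right _ (by positivity)
      linarith
    linarith
  · rw [add_right_inj, div_left_inj' (by positivity)]
    simp only [Set.mem_insert_iff, Set.mem_singleton_iff, Prod.mk.injEq]
    constructor
    · intro h
      rcases hb.1 (by linarith) with hb | hb <;> rcases hc.1 (by linarith) with hc | hc
      · exact Or.inl ⟨hb, hc⟩
      · exact Or.inr (Or.inl ⟨hb, hc⟩)
      · exfalso; rw [hb, hc] at hbc; norm_num at hbc
      · exact Or.inr (Or.inr ⟨hb, hc⟩)
    · intro h
      have h1 : b = 1/8 ∨ b = 5/8 := by tauto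
      have h2 : c = 3/8 ∨ c = 7/8 := by tauto
      linarith [hb.2 h1, hc.2 h2]
end
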